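/- Every cyclically ordered abelian group (G,R) admits a c-divisible extension: there exist a cyclically ordered abelian group (G',R') such that G' is divisible and contains a nonzero element of finite order, and a c-embedding φ : (G,R) → (G',R'). -/

import Mathlib

universe u

/-- A cyclic order on an (additive) abelian group: a ternary relation that is strict, cyclic,
such that the induced binary relation at each point is transitive and total on distinct triples,
and which is compatible with translation. -/
def IsCyclicOrder {G : Type*} [AddCommGroup G] (R : G → G → G → Prop) : Prop :=
  (∀ a b c : G, R a b c → a ≠ b ∧ b ≠ c ∧ c ≠ a) ∧
  (∀ a b c : G, R a b c → R b c a) ∧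
  (∀ a b c d : G, R a b c → R a c d → R a b d) ∧
  (∀ a b c : G, a ≠ b → b ≠ c → c ≠ a → R a b c ∨ R a c b) ∧
  (∀ a b c x : G, R a b c → R (a + x) (b + x) (c + x))

/-- A (bundled) cyclically ordered abelian group. -/
structure CycOrdAbGroup : Type (u + 1) where
  carrier : Type u
  [grp : AddCommGroup carrier]
  R : carrier → carrier → carrier → Prop
  cyc : IsCyclicOrder R

attribute [instance] CycOrdAbGroup.grp

/-! ### The wound-round cyclic order on a quotient by a cofinal element -/

section Quotient

theorem mk_zsmul_eq_zero {L : Type*} [AddCommGroup L] (z : L) (k : ℤ) :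
    ((k • z : L) : L ⧸ AddSubgroup.zmultiples z) = 0 :=
  (QuotientAddGroup.eq_zero_iff _).2 (AddSubgroup.zsmul_mem_zmultiples z k)

variable {L : Type*} [AddCommGroup L] [LinearOrder L]

/-- The cyclic order on the quotient of a linearly ordered group by the multiples of `z`:
three classes are in cyclic order when they have increasing representatives within one turn. -/
def windingRel (z : L) (a b c : L ⧸ AddSubgroup.zmultiples z) : Prop :=
  ∃ x y w : L, (x : L ⧸ AddSubgroup.zmultiples z) = a ∧ (y : L ⧸ AddSubgroup.zmultiples z) = b ∧
    (w : L ⧸ AddSubgroup.zmultiples z) = c ∧ x < y ∧ y < w ∧ w < x + z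

variable [IsOrderedAddMonoid L] {z : L}

/-- Two representatives of the same class less than one turn apart are equal. -/
theorem eq_of_mk_eq_mk_of_lt_of_lt (hz : 0 < z) {x y : L}
    (h : (x : L ⧸ AddSubgroup.zmultiples z) = y) (hxy : x < y + z) (hyx : y < x + z) :
    x = y := by
  rw [QuotientAddGroup.eq, AddSubgroup.mem_zmultiples_iff] at h
  obtain ⟨k, hk⟩ := h
  have h₁ : k • z < (1 : ℤ) • z := by
    rw [hk, one_zsmul, neg_add_lt_iff_lt_add]
    exact hyx
  have h₂ : (-1 : ℤ) • z < k • z := by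
    rw [hk, neg_one_zsmul, lt_neg_add_iff_add_lt, ← sub_eq_add_neg, sub_lt_iff_lt_add]
    exact hxy
  have hk₀ : k = 0 := by
    have := (zsmul_lt_zsmul_iff_left hz).1 h₁
    have := (zsmul_lt_zsmul_iff_left hz).1 h₂
    omega
  rw [hk₀, zero_zsmul] at hk
  exact neg_add_eq_zero.1 hk.symm

/-- When `z` is cofinal, every class has a representative in any given turn. -/
theorem exists_mk_eq_of_cofinal (hz : 0 < z) (hcof : ∀ x : L, ∃ n : ℕ, x ≤ n • z) (x : L)
    (a : L ⧸ AddSubgroup.zmultiples z) :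
    ∃ y : L, (y : L ⧸ AddSubgroup.zmultiples z) = a ∧ x ≤ y ∧ y < x + z := by
  classical
  obtain ⟨w, rfl⟩ := QuotientAddGroup.mk_surjective a
  obtain ⟨m, hm⟩ := hcof (w - x)
  have hex : ∃ n : ℕ, x ≤ w - m • z + n • z := by
    obtain ⟨n, hn⟩ := hcof (x - w + m • z)
    refine ⟨n, ?_⟩
    rw [← sub_nonneg] at hn ⊢
    convert hn using 1
    abel
  have hspec := Nat.find_spec hex
  set n := Nat.find hex
  refine ⟨w - m • z + n • z, ?_, hspec, ?_⟩
  · rw [QuotientAddGroup.eq, AddSubgroup.mem_zmultiples_iff]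
    refine ⟨m - n, ?_⟩
    rw [sub_zsmul, natCast_zsmul, natCast_zsmul]
    abel
  · rcases Nat.eq_zero_or_pos n with h0 | hpos
    · rw [h0, zero_nsmul]
      rw [← sub_nonneg] at hm
      rw [← sub_pos]
      refine lt_of_lt_of_le hz ?_
      rw [← sub_nonneg]
      convert hm using 1
      abel
    · have := Nat.find_min hex (m := n - 1) (by omega)
      rw [not_le] at this
      obtain ⟨k, hk⟩ : ∃ k, n = k + 1 := ⟨n - 1, by omega⟩
      rw [hk, Nat.add_sub_cancel] at this
      rw [hk, succ_nsmul]
      rw [← sub_pos] at this ⊢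
      convert this using 1
      abel

theorem windingRel_rotate {a b c : L ⧸ AddSubgroup.zmultiples z} (h : windingRel z a b c) :
    windingRel z b c a := by
  obtain ⟨x, y, w, rfl, rfl, rfl, hxy, hyw, hwx⟩ := h
  exact ⟨y, w, x + z, rfl, rfl, by simp, hyw, hwx, by gcongr⟩

theorem windingRel_ne (hz : 0 < z) {a b c : L ⧸ AddSubgroup.zmultiples z}
    (h : windingRel z a b c) : a ≠ b := by
  obtain ⟨x, y, w, rfl, rfl, rfl, hxy, hyw, hwx⟩ := h
  intro h
  exact hxy.ne (eq_of_mk_eq_mk_of_lt_of_lt hz h (hxy.trans (lt_add_of_pos_right y hz))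
    (hyw.trans hwx))

theorem windingRel_add {a b c : L ⧸ AddSubgroup.zmultiples z}
    (h : windingRel z a b c) (d : L ⧸ AddSubgroup.zmultiples z) :
    windingRel z (a + d) (b + d) (c + d) := by
  obtain ⟨x, y, w, rfl, rfl, rfl, hxy, hyw, hwx⟩ := h
  obtain ⟨v, rfl⟩ := QuotientAddGroup.mk_surjective d
  refine ⟨x + v, y + v, w + v, rfl, rfl, rfl, by gcongr, by gcongr, ?_⟩
  rw [add_right_comm]
  gcongr

theorem windingRel_trans (hz : 0 < z) {a b c d : L ⧸ AddSubgroup.zmultiples z}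
    (h : windingRel z a b c) (h' : windingRel z a c d) : windingRel z a b d := by
  obtain ⟨x, y, w, rfl, rfl, rfl, hxy, hyw, hwx⟩ := h
  obtain ⟨x', w', v, hx', hw', rfl, hxw', hwv', hvx'⟩ := h'
  rw [eq_comm, QuotientAddGroup.eq, AddSubgroup.mem_zmultiples_iff] at hx'
  obtain ⟨k, hk⟩ := hx'
  obtain rfl : x' = x + k • z := by rw [hk]; abel
  have hw : w' - k • z = w := by
    apply eq_of_mk_eq_mk_of_lt_of_lt hz
    · rw [← hw', QuotientAddGroup.mk_sub, mk_zsmul_eq_zero, sub_zero]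
    · rw [sub_lt_iff_lt_add]
      calc w' < x + k • z + z := hwv'.trans hvx'
        _ < w + k • z + z := by gcongr; exact hxy.trans hyw
        _ = w + z + k • z := by abel
    · refine hwx.trans ?_
      gcongr
      rwa [lt_sub_iff_add_lt]
  obtain rfl : w' = w + k • z := by rw [← hw]; abel
  refine ⟨x, y, v - k • z, rfl, rfl, ?_, hxy, hyw.trans ?_, ?_⟩
  · rw [QuotientAddGroup.mk_sub, mk_zsmul_eq_zero, sub_zero]
  · rwa [lt_sub_iff_add_lt]
  · rw [sub_lt_iff_lt_add, add_right_comm]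
    exact hvx'

theorem windingRel_total (hz : 0 < z) (hcof : ∀ x : L, ∃ n : ℕ, x ≤ n • z)
    {a b c : L ⧸ AddSubgroup.zmultiples z} (hab : a ≠ b) (hbc : b ≠ c) (hca : c ≠ a) :
    windingRel z a b c ∨ windingRel z a c b := by
  obtain ⟨x, rfl⟩ := QuotientAddGroup.mk_surjective a
  obtain ⟨y, rfl, hxy, hyx⟩ := exists_mk_eq_of_cofinal hz hcof x b
  obtain ⟨w, rfl, hxw, hwx⟩ := exists_mk_eq_of_cofinal hz hcof x c
  have hxy' : x < y := lt_of_le_of_ne hxy (by rintro rfl; exact hab rfl)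
  have hxw' : x < w := lt_of_le_of_ne hxw (by rintro rfl; exact hca rfl)
  have hyw : y ≠ w := by rintro rfl; exact hbc rfl
  rcases hyw.lt_or_gt with h | h
  · exact .inl ⟨x, y, w, rfl, rfl, rfl, hxy', h, hwx⟩
  · exact .inr ⟨x, w, y, rfl, rfl, rfl, hxw', h, hyx⟩

theorem isCyclicOrder_windingRel (hz : 0 < z) (hcof : ∀ x : L, ∃ n : ℕ, x ≤ n • z) :
    IsCyclicOrder (windingRel z) :=
  ⟨fun _ _ _ h ↦ ⟨windingRel_ne hz h, windingRel_ne hz (windingRel_rotate h),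
      windingRel_ne hz (windingRel_rotate (windingRel_rotate h))⟩,
    fun _ _ _ ↦ windingRel_rotate, fun _ _ _ _ ↦ windingRel_trans hz,
    fun _ _ _ ↦ windingRel_total hz hcof, fun _ _ _ d h ↦ windingRel_add h d⟩

end Quotient

/-! ### Cyclic orders and their winding cocycle -/

namespace IsCyclicOrder

variable {G : Type*} [AddCommGroup G] {R : G → G → G → Prop}

theorem ne (hR : IsCyclicOrder R) {a b c : G} (h : R a b c) : a ≠ b ∧ b ≠ c ∧ c ≠ a :=
  hR.1 a b c h

theorem rotate (hR : IsCyclicOrder R) {a b c : G} (h : R a b c) : R b c a :=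
  hR.2.1 a b c h

theorem trans (hR : IsCyclicOrder R) {a b c d : G} (h : R a b c) (h' : R a c d) : R a b d :=
  hR.2.2.1 a b c d h h'

theorem total (hR : IsCyclicOrder R) {a b c : G} (hab : a ≠ b) (hbc : b ≠ c) (hca : c ≠ a) :
    R a b c ∨ R a c b :=
  hR.2.2.2.1 a b c hab hbc hca

theorem add (hR : IsCyclicOrder R) {a b c : G} (h : R a b c) (x : G) :
    R (a + x) (b + x) (c + x) :=
  hR.2.2.2.2 a b c x h

theorem asymm (hR : IsCyclicOrder R) {a b c : G} (h : R a b c) : ¬ R a c b :=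
  fun h' ↦ (hR.ne (hR.trans h h')).2.1 rfl

theorem sub_of_zero (hR : IsCyclicOrder R) {x y : G} (h : R 0 x y) : R 0 x (x - y) := by
  obtain ⟨hx, -, hy⟩ := hR.ne h
  by_contra hcon
  have hB : R 0 (x - y) x := by
    by_cases hxy : x - y = 0
    · exact absurd (sub_eq_zero.1 hxy) (hR.ne h).2.1
    · exact (hR.total hx (fun h' ↦ hy (sub_eq_self.1 h'.symm)) hxy).resolve_left hcon
  have hA : R (-x - y) (-y) (-x) := by
    convert hR.add h (-x - y) using 1 <;> abel
  have hB' : R (-x) (-y) 0 := by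
    convert hR.add hB (-x) using 1 <;> abel
  have h₁ : R 0 y (-x) := by
    convert hR.add (hR.trans (hR.rotate hB') (hR.rotate hA)) y using 1 <;> abel
  have h₂ : R 0 (-y) x := by
    convert hR.add (hR.trans (hR.rotate (hR.rotate hA)) hB') x using 1 <;> abel
  exact hR.asymm (hR.rotate (hR.rotate hB')) (hR.trans (hR.trans h₂ h) h₁)

/-- One if going from `p` through `q` to `r` in the positive direction passes `p` again. -/
noncomputable def wind (_ : IsCyclicOrder R) (p q r : G) : ℤ :=
  open Classical in if R p r q ∨ p = r ∧ p ≠ q then 1 else 0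

theorem wind_cocycle (hR : IsCyclicOrder R) (p q r s : G) :
    hR.wind q r s + hR.wind p q s = hR.wind p r s + hR.wind p q r := by
  have h1 := @hR.ne
  have h2 := @hR.rotate
  have h3 := @hR.trans
  have h4 := @hR.total
  have h5 := @hR.asymm
  unfold wind
  by_cases hpq : p = q
  · grind
  by_cases hpr : p = r
  · grind
  by_cases hps : p = s
  · grind
  by_cases hqr : q = r
  · grind
  by_cases hqs : q = s
  · grind
  by_cases hrs : r = s
  · grind
  grind

theorem add_iff (hR : IsCyclicOrder R) {a b c : G} (x : G) :
    R (a + x) (b + x) (c + x) ↔ R a b c :=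
  ⟨fun h ↦ by simpa using hR.add h (-x), fun h ↦ hR.add h x⟩

theorem wind_add (hR : IsCyclicOrder R) (p q r x : G) :
    hR.wind (p + x) (q + x) (r + x) = hR.wind p q r := by
  unfold wind
  congr 1
  rw [hR.add_iff, add_left_inj, ne_eq, add_left_inj]

theorem wind_nonneg (hR : IsCyclicOrder R) (p q r : G) : 0 ≤ hR.wind p q r := by
  unfold wind
  split_ifs <;> simp

theorem wind_le_one (hR : IsCyclicOrder R) (p q r : G) : hR.wind p q r ≤ 1 := by
  unfold wind
  split_ifs <;> simp

/-- The number of turns gained when adding `a` and `b`. -/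
noncomputable def carry (hR : IsCyclicOrder R) (a b : G) : ℤ :=
  hR.wind 0 a (a + b)

theorem carry_assoc (hR : IsCyclicOrder R) (a b c : G) :
    hR.carry a b + hR.carry (a + b) c = hR.carry b c + hR.carry a (b + c) := by
  have h := hR.wind_cocycle 0 a (a + b) (a + b + c)
  have h' : hR.wind a (a + b) (a + b + c) = hR.wind 0 b (b + c) := by
    rw [← hR.wind_add 0 b (b + c) a]
    congr 1 <;> abel
  rw [h'] at h
  unfold carry
  rw [← add_assoc a b c, h, add_comm]

theorem carry_comm (hR : IsCyclicOrder R) (a b : G) : hR.carry a b = hR.carry b a := by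
  have key : ∀ a b : G, R 0 (a + b) a → R 0 (a + b) b := fun a b h ↦ by
    simpa using hR.sub_of_zero h
  have key' : ∀ a b : G, 0 = a + b → 0 ≠ a → 0 ≠ b := fun a b h ha hb ↦ by
    apply ha
    rw [h, ← hb, add_zero]
  unfold carry wind
  rw [add_comm b a]
  congr 1
  apply propext
  constructor
  · rintro (h | ⟨h, h'⟩)
    · exact .inl (key a b h)
    · exact .inr ⟨h, key' a b h h'⟩
  · rw [add_comm a b]
    rintro (h | ⟨h, h'⟩)
    · exact .inl (key b a h)
    · exact .inr ⟨h, key' b a h h'⟩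

theorem carry_nonneg (hR : IsCyclicOrder R) (a b : G) : 0 ≤ hR.carry a b :=
  hR.wind_nonneg ..

theorem carry_le_one (hR : IsCyclicOrder R) (a b : G) : hR.carry a b ≤ 1 :=
  hR.wind_le_one ..

theorem carry_zero (hR : IsCyclicOrder R) (a : G) : hR.carry a 0 = 0 := by
  have : ¬ R 0 a a := fun h ↦ (hR.ne h).2.1 rfl
  simp +contextual [carry, wind, this]

theorem zero_carry (hR : IsCyclicOrder R) (a : G) : hR.carry 0 a = 0 := by
  rw [carry_comm, carry_zero]

theorem carry_neg_self (hR : IsCyclicOrder R) {a : G} (ha : a ≠ 0) : hR.carry (-a) a = 1 := by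
  simp [carry, wind, ha]

theorem carry_sub_of_zero (hR : IsCyclicOrder R) {a b : G} (h : R 0 a b) :
    hR.carry a (b - a) = 0 := by
  have := hR.asymm h
  simp [carry, wind, this, (hR.ne h).2.2.symm]

/-- The unwinding of a cyclically ordered group: pairs of a number of turns and a point, added
with carry. -/
@[ext]
structure Unwinding (hR : IsCyclicOrder R) where
  /-- The number of full turns. -/
  turn : ℤ
  /-- The point reached. -/
  pt : G

namespace Unwinding

variable {hR : IsCyclicOrder R}

instance : Zero hR.Unwinding := ⟨⟨0, 0⟩⟩

noncomputable instance : Add hR.Unwinding :=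
  ⟨fun x y ↦ ⟨x.turn + y.turn + hR.carry x.pt y.pt, x.pt + y.pt⟩⟩

noncomputable instance : Neg hR.Unwinding :=
  ⟨fun x ↦ ⟨-x.turn - hR.carry (-x.pt) x.pt, -x.pt⟩⟩

@[simp] theorem turn_zero : (0 : hR.Unwinding).turn = 0 := rfl
@[simp] theorem pt_zero : (0 : hR.Unwinding).pt = 0 := rfl
@[simp] theorem turn_add (x y : hR.Unwinding) :
    (x + y).turn = x.turn + y.turn + hR.carry x.pt y.pt := rfl
@[simp] theorem pt_add (x y : hR.Unwinding) : (x + y).pt = x.pt + y.pt := rfl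
@[simp] theorem turn_neg (x : hR.Unwinding) :
    (-x).turn = -x.turn - hR.carry (-x.pt) x.pt := rfl
@[simp] theorem pt_neg (x : hR.Unwinding) : (-x).pt = -x.pt := rfl

noncomputable instance : AddCommGroup hR.Unwinding where
  add_assoc x y w := by
    have := hR.carry_assoc x.pt y.pt w.pt
    ext
    · simp only [turn_add, pt_add]
      linarith
    · simp [add_assoc]
  zero_add x := by ext <;> simp [zero_carry]
  add_zero x := by ext <;> simp [carry_zero]
  neg_add_cancel x := by ext <;> simp [sub_add]
  add_comm x y := by
    ext
    · simp [carry_comm hR x.pt, add_comm x.turn]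
    · simp [add_comm]
  nsmul := nsmulRec
  zsmul := zsmulRec

/-- The positive cone of the unwinding. -/
noncomputable def cone (hR : IsCyclicOrder R) : AddGroupCone hR.Unwinding where
  carrier := {x | 0 ≤ x.turn}
  zero_mem' := by simp
  add_mem' {x y} hx hy := add_nonneg (add_nonneg hx hy) (hR.carry_nonneg _ _)
  eq_zero_of_mem_of_neg_mem' {x} hx hx' := by
    simp only [Set.mem_ofPred_eq, turn_neg] at hx hx'
    have := hR.carry_nonneg (-x.pt) x.pt
    by_cases h : x.pt = 0
    · ext
      · simp only [turn_zero]
        omega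
      · exact h
    · rw [hR.carry_neg_self h] at hx'
      omega

theorem mem_cone {x : hR.Unwinding} : x ∈ cone hR ↔ 0 ≤ x.turn := by
  change x ∈ {x : hR.Unwinding | 0 ≤ x.turn} ↔ _
  simp

instance : HasMemOrNegMem (cone hR) where
  mem_or_neg_mem x := by
    rw [mem_cone, mem_cone, turn_neg]
    have := hR.carry_le_one (-x.pt) x.pt
    omega

noncomputable instance : LinearOrder hR.Unwinding :=
  open Classical in LinearOrder.mkOfAddGroupCone (cone hR)

instance : IsOrderedAddMonoid hR.Unwinding :=
  IsOrderedAddMonoid.mkOfCone (cone hR)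

theorem le_iff {x y : hR.Unwinding} : x ≤ y ↔ 0 ≤ (y - x).turn := mem_cone

/-- The element of the unwinding that makes one full turn. -/
def oneTurn (hR : IsCyclicOrder R) : hR.Unwinding := ⟨1, 0⟩

theorem nsmul_oneTurn (n : ℕ) : n • oneTurn hR = ⟨n, 0⟩ := by
  induction n with
  | zero => rw [zero_nsmul]; rfl
  | succ n ih =>
    rw [succ_nsmul, ih]
    ext <;> simp [oneTurn, carry_zero]

theorem oneTurn_pos : 0 < oneTurn hR := by
  refine lt_of_le_of_ne ?_ ?_
  · rw [le_iff, sub_zero]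
    exact zero_le_one
  · intro h
    exact zero_ne_one (congrArg turn h)

theorem exists_le_nsmul_oneTurn (x : hR.Unwinding) : ∃ n : ℕ, x ≤ n • oneTurn hR := by
  refine ⟨(x.turn + 1).toNat, ?_⟩
  rw [nsmul_oneTurn, le_iff, sub_eq_add_neg, turn_add, turn_neg, zero_carry]
  have := hR.carry_le_one (-x.pt) x.pt
  dsimp only
  omega

/-- The lift of a point without any full turn. -/
def lift (hR : IsCyclicOrder R) (a : G) : hR.Unwinding := ⟨0, a⟩

theorem lift_add_lift (a b : G) :
    lift hR a + lift hR b = lift hR (a + b) ∨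
      lift hR a + lift hR b = oneTurn hR + lift hR (a + b) := by
  have h₀ := hR.carry_nonneg a b
  have h₁ := hR.carry_le_one a b
  obtain h | h : hR.carry a b = 0 ∨ hR.carry a b = 1 := by omega
  · left
    ext <;> simp [lift, h]
  · right
    ext <;> simp [lift, oneTurn, h, zero_carry]

theorem lift_lt_oneTurn (a : G) : lift hR a < oneTurn hR := by
  refine lt_of_le_of_ne ?_ fun h ↦ zero_ne_one (congrArg turn h)
  rw [le_iff, sub_eq_add_neg, turn_add, turn_neg]
  have h := hR.carry_le_one (-a) a
  simp only [oneTurn, lift, zero_carry]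
  omega

theorem lift_pos {a : G} (ha : a ≠ 0) : 0 < lift hR a := by
  refine lt_of_le_of_ne ?_ fun h ↦ ha (congrArg pt h).symm
  rw [le_iff, sub_zero]
  exact le_rfl

theorem lift_lt_lift {a b : G} (h : R 0 a b) : lift hR a < lift hR b := by
  have hab : lift hR b = lift hR a + lift hR (b - a) := by
    ext <;> simp [lift, hR.carry_sub_of_zero h]
  rw [hab]
  exact lt_add_of_pos_right _ (lift_pos (sub_ne_zero.2 (hR.ne h).2.1.symm))

end Unwinding

open Unwinding

/-- The full turn in the divisible hull of the unwinding. -/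
noncomputable def hullTurn (hR : IsCyclicOrder R) : DivisibleHull hR.Unwinding :=
  DivisibleHull.coeAddMonoidHom _ (oneTurn hR)

theorem coe_hull_pos {hR : IsCyclicOrder R} {x : hR.Unwinding} (hx : 0 < x) :
    0 < DivisibleHull.coeAddMonoidHom _ x := by
  rw [← DivisibleHull.mk_zero 1, DivisibleHull.coeAddMonoidHom_apply, DivisibleHull.mk_lt_mk]
  simpa using hx

theorem hullTurn_pos (hR : IsCyclicOrder R) : 0 < hR.hullTurn :=
  coe_hull_pos oneTurn_pos

theorem exists_le_nsmul_hullTurn (hR : IsCyclicOrder R) (x : DivisibleHull hR.Unwinding) :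
    ∃ n : ℕ, x ≤ n • hR.hullTurn := by
  induction x with | mk x s
  obtain ⟨n, hn⟩ := exists_le_nsmul_oneTurn x
  refine ⟨n, ?_⟩
  rw [hullTurn, DivisibleHull.coeAddMonoidHom_apply, DivisibleHull.nsmul_mk,
    DivisibleHull.mk_le_mk, PNat.one_coe, one_nsmul]
  refine hn.trans ?_
  conv_lhs => rw [← one_nsmul (n • oneTurn hR)]
  exact nsmul_le_nsmul_left (nsmul_nonneg oneTurn_pos.le n) s.pos

/-- The circle obtained from the divisible hull of the unwinding. -/
abbrev HullCircle (hR : IsCyclicOrder R) :=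
  DivisibleHull hR.Unwinding ⧸ AddSubgroup.zmultiples hR.hullTurn

/-- The embedding of a cyclically ordered group in the circle of its hull. -/
noncomputable def toHullCircle (hR : IsCyclicOrder R) : G →+ hR.HullCircle :=
  AddMonoidHom.mk' (fun a ↦ (DivisibleHull.coeAddMonoidHom _ (lift hR a) : DivisibleHull hR.Unwinding)) fun a b ↦ by
    rw [← QuotientAddGroup.mk_add, ← map_add]
    rcases lift_add_lift (hR := hR) a b with h | h
    · rw [h]
    · rw [h, map_add, QuotientAddGroup.mk_add]
      have : ((DivisibleHull.coeAddMonoidHom _ (oneTurn hR) : DivisibleHull hR.Unwinding) :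
          DivisibleHull hR.Unwinding ⧸ AddSubgroup.zmultiples hR.hullTurn) = 0 := by
        rw [← mk_zsmul_eq_zero hR.hullTurn 1, one_zsmul, hullTurn]
      rw [this, zero_add]

theorem toHullCircle_apply (hR : IsCyclicOrder R) (a : G) :
    hR.toHullCircle a = (DivisibleHull.coeAddMonoidHom _ (lift hR a) : hR.HullCircle) := rfl

theorem windingRel_of_zero (hR : IsCyclicOrder R) {a b : G} (h : R 0 a b) :
    windingRel hR.hullTurn 0 (hR.toHullCircle a) (hR.toHullCircle b) := by
  refine ⟨0, _, _, rfl, (hR.toHullCircle_apply a).symm, (hR.toHullCircle_apply b).symm, ?_, ?_, ?_⟩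
  · exact coe_hull_pos (lift_pos (hR.ne h).1.symm)
  · simpa using lift_lt_lift h
  · rw [zero_add]
    simpa [hullTurn] using lift_lt_oneTurn b

theorem windingRel_toHullCircle (hR : IsCyclicOrder R) {a b c : G} (h : R a b c) :
    windingRel hR.hullTurn (hR.toHullCircle a) (hR.toHullCircle b) (hR.toHullCircle c) := by
  have h₀ : R 0 (b - a) (c - a) := by simpa [sub_eq_add_neg] using hR.add h (-a)
  simpa using windingRel_add (hR.windingRel_of_zero h₀) (hR.toHullCircle a)

theorem toHullCircle_injective (hR : IsCyclicOrder R) :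
    Function.Injective hR.toHullCircle := by
  rw [injective_iff_map_eq_zero]
  intro a ha
  by_contra hne
  have hpos : 0 < DivisibleHull.coeAddMonoidHom _ (lift hR a) :=
    coe_hull_pos (lift_pos hne)
  have hlt : DivisibleHull.coeAddMonoidHom _ (lift hR a) < hR.hullTurn := by
    simpa [hullTurn] using lift_lt_oneTurn a
  refine hpos.ne' (eq_of_mk_eq_mk_of_lt_of_lt hR.hullTurn_pos ha ?_ ?_)
  · rwa [zero_add]
  · exact hpos.trans (lt_add_of_pos_right _ hR.hullTurn_pos)

theorem exists_nsmul_eq (hR : IsCyclicOrder R) {n : ℕ} (hn : 1 ≤ n) (a : hR.HullCircle) :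
    ∃ b : hR.HullCircle, n • b = a := by
  obtain ⟨x, rfl⟩ := QuotientAddGroup.mk_surjective a
  refine ⟨(((n : ℚ)⁻¹ • x : DivisibleHull hR.Unwinding) : hR.HullCircle), ?_⟩
  rw [← QuotientAddGroup.mk_nsmul, ← Nat.cast_smul_eq_nsmul ℚ, smul_inv_smul₀]
  exact Nat.cast_ne_zero.2 (by omega)

theorem exists_ne_zero_isOfFinAddOrder (hR : IsCyclicOrder R) :
    ∃ g : hR.HullCircle, g ≠ 0 ∧ IsOfFinAddOrder g := by
  set x : DivisibleHull hR.Unwinding := (2 : ℚ)⁻¹ • hR.hullTurn with hx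
  have hxx : x + x = hR.hullTurn := by
    rw [hx, ← add_smul]
    norm_num
  have hpos : 0 < x := by
    by_contra! h
    exact (hxx ▸ hR.hullTurn_pos).not_ge (add_nonpos h h)
  refine ⟨x, fun h ↦ ?_, ?_⟩
  · refine hpos.ne' (eq_of_mk_eq_mk_of_lt_of_lt hR.hullTurn_pos h ?_ ?_)
    · rw [zero_add, ← hxx]
      exact lt_add_of_pos_right x hpos
    · exact hpos.trans (lt_add_of_pos_right _ hR.hullTurn_pos)
  · refine isOfFinAddOrder_iff_nsmul_eq_zero.2 ⟨2, two_pos, ?_⟩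
    rw [← QuotientAddGroup.mk_nsmul, two_nsmul, hxx]
    simp

end IsCyclicOrder

/-- Every cyclically ordered abelian group admits a c-divisible extension: it
c-embeds into a cyclically ordered abelian group which is divisible and has a nonzero element
of finite order. -/
theorem exists_cDivisible_extension
    {G : Type u} [AddCommGroup G] (R : G → G → G → Prop) (hR : IsCyclicOrder R) :
    ∃ (H : CycOrdAbGroup.{u}) (φ : G →+ H.carrier),
      (∀ n : ℕ, 1 ≤ n → ∀ a : H.carrier, ∃ b : H.carrier, n • b = a) ∧
      (∃ g : H.carrier, g ≠ 0 ∧ IsOfFinAddOrder g) ∧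
      Function.Injective φ ∧
      (∀ a b c : G, R a b c ↔ H.R (φ a) (φ b) (φ c)) := by
  have hcyc := isCyclicOrder_windingRel hR.hullTurn_pos hR.exists_le_nsmul_hullTurn
  refine ⟨⟨hR.HullCircle, windingRel hR.hullTurn, hcyc⟩, hR.toHullCircle,
    fun n hn ↦ hR.exists_nsmul_eq hn, hR.exists_ne_zero_isOfFinAddOrder,
    hR.toHullCircle_injective, fun a b c ↦ ⟨hR.windingRel_toHullCircle, fun h ↦ ?_⟩⟩
  obtain ⟨hab, hbc, hca⟩ := hcyc.ne h
  refine (hR.total (ne_of_apply_ne _ hab) (ne_of_apply_ne _ hbc)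
    (ne_of_apply_ne _ hca)).resolve_right fun h' ↦ ?_
  exact hcyc.asymm h (hR.windingRel_toHullCircle h')
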